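/- arXiv:1705.05880 — 4 statements merged into one kernel-verified Lean document; each statement's English description precedes it below -/
import Mathlib

section
/- Let ψ : E_A → ℝ be locally Hölder continuous with local Hölder exponent β > 0 and constant C > 0. Then ψ is cohomologous to a past-independent locally Hölder continuous function via a bounded Hölder coboundary: there exists a bounded function u : E_A → ℝ that is Lipschitz continuous with respect to the metric d_{β/2} such that ψ⁺ := ψ − u + u∘σ is locally Hölder continuous and past-independent, i.e. ψ⁺(ω) = ψ⁺(τ) whenever ω|₀^{+∞} = τ|₀^{+∞}. -/
open MeasureTheory Filter Set Topology

open scoped ENNReal Classical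

namespace Paper

variable {E : Type*}

/-- Two-sided shift space over alphabet `E` with incidence matrix `A`. -/
abbrev EA (A : E → E → Bool) : Type _ :=
  {ω : ℤ → E // ∀ n : ℤ, A (ω n) (ω (n + 1)) = true}

/-- One-sided shift space over alphabet `E` with incidence matrix `A`. -/
abbrev EAplus (A : E → E → Bool) : Type _ :=
  {ω : ℕ → E // ∀ n : ℕ, A (ω n) (ω (n + 1)) = true}

/-- A finite word is `A`-admissible if consecutive letters are linked by `A`. -/
def IsAdmissibleList (A : E → E → Bool) : List E → Prop :=
  List.Chain' (fun c d => A c d = true)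

/-- The incidence matrix `A` is finitely irreducible. -/
def FinitelyIrreducible (A : E → E → Bool) : Prop :=
  ∃ Λ : Finset (List E), (∀ γ ∈ Λ, IsAdmissibleList A γ) ∧
    ∀ a b : E, ∃ γ ∈ Λ, IsAdmissibleList A (a :: (γ ++ [b]))

/-- The incidence matrix `A` is irreducible. -/
def IrreducibleMat (A : E → E → Bool) : Prop :=
  ∀ a b : E, ∃ w : List E, IsAdmissibleList A (a :: (w ++ [b]))

variable {A : E → E → Bool}

/-- The two-sided shift map. -/
def shift (A : E → E → Bool) (ω : EA A) : EA A :=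
  ⟨fun n => ω.1 (n + 1), fun n => ω.2 (n + 1)⟩

/-- The one-sided shift map. -/
def shiftPlus (A : E → E → Bool) (ω : EAplus A) : EAplus A :=
  ⟨fun n => ω.1 (n + 1), fun n => ω.2 (n + 1)⟩

/-- Canonical projection from the two-sided to the one-sided shift space:
`π₁(τ) = τ|₀^{+∞}`. -/
def proj1 (A : E → E → Bool) (τ : EA A) : EAplus A :=
  ⟨fun n => τ.1 (n : ℤ), fun n => by simpa using τ.2 (n : ℤ)⟩

/-- `ω` and `τ` agree on all coordinates `k` with `|k| ≤ n`. -/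
def agreeTwo (ω τ : EA A) (n : ℕ) : Prop :=
  ∀ k : ℤ, |k| ≤ (n : ℤ) → ω.1 k = τ.1 k

/-- `ω` and `τ` agree on all coordinates `0 ≤ k ≤ n`. -/
def agreePlus (ω τ : EAplus A) (n : ℕ) : Prop :=
  ∀ k : ℕ, k ≤ n → ω.1 k = τ.1 k

/-- The metric `d_β` on the two-sided shift space:
`d_β(ω,τ) = exp (-β * max{n ≥ -1 : ω and τ agree up to n})`. -/
noncomputable def dist2 (A : E → E → Bool) (β : ℝ) (ω τ : EA A) : ℝ :=
  ⨅ n : ℕ, if agreeTwo ω τ n then Real.exp (-β * n) else Real.exp β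

/-- The metric `d_β` on the one-sided shift space. -/
noncomputable def dist1 (A : E → E → Bool) (β : ℝ) (ω τ : EAplus A) : ℝ :=
  ⨅ n : ℕ, if agreePlus ω τ n then Real.exp (-β * n) else Real.exp β

/-- `ψ` is locally Hölder continuous with exponent `β` and constant `C`. -/
def LocHolderTwo (A : E → E → Bool) (β C : ℝ) (ψ : EA A → ℝ) : Prop :=
  ∀ ω τ : EA A, ω.1 0 = τ.1 0 → ∀ n : ℕ, agreeTwo ω τ n →
    |ψ ω - ψ τ| ≤ C * Real.exp (-β * n)

/-- `ψ` is locally Hölder continuous (for some exponent and constant). -/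
def LocallyHolderTwo (A : E → E → Bool) (ψ : EA A → ℝ) : Prop :=
  ∃ β C : ℝ, 0 < β ∧ 0 < C ∧ LocHolderTwo A β C ψ

/-- One-sided local Hölder continuity with given exponent and constant. -/
def LocHolderPlus (A : E → E → Bool) (β C : ℝ) (ψ : EAplus A → ℝ) : Prop :=
  ∀ ω τ : EAplus A, ω.1 0 = τ.1 0 → ∀ n : ℕ, agreePlus ω τ n →
    |ψ ω - ψ τ| ≤ C * Real.exp (-β * n)

def LocallyHolderPlus (A : E → E → Bool) (ψ : EAplus A → ℝ) : Prop :=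
  ∃ β C : ℝ, 0 < β ∧ 0 < C ∧ LocHolderPlus A β C ψ

/-- Birkhoff sum `S_n ψ` for the two-sided shift. -/
noncomputable def birk (A : E → E → Bool) (ψ : EA A → ℝ) (n : ℕ) (ω : EA A) : ℝ :=
  ∑ j ∈ Finset.range n, ψ ((shift A)^[j] ω)

/-- Birkhoff sum `S_n ψ` for the one-sided shift. -/
noncomputable def birkPlus (A : E → E → Bool) (ψ : EAplus A → ℝ) (n : ℕ) (ω : EAplus A) : ℝ :=
  ∑ j ∈ Finset.range n, ψ ((shiftPlus A)^[j] ω)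

/-- The cylinder in `EA A` fixing coordinates `0,…,|w|-1` to the word `w`. -/
def cylList (A : E → E → Bool) (w : List E) : Set (EA A) :=
  {τ | ∀ k : Fin w.length, τ.1 ((k : ℕ) : ℤ) = w.get k}

/-- The cylinder in `EAplus A` fixing coordinates `0,…,|w|-1` to the word `w`. -/
def cylListPlus (A : E → E → Bool) (w : List E) : Set (EAplus A) :=
  {τ | ∀ k : Fin w.length, τ.1 (k : ℕ) = w.get k}

/-- Logarithm `ℝ≥0∞ → EReal`, with `log 0 = ⊥` and `log ⊤ = ⊤`. -/
noncomputable def elog (x : ℝ≥0∞) : EReal :=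
  if x = 0 then ⊥ else if x = ⊤ then ⊤ else ((Real.log x.toReal : ℝ) : EReal)

/-- Partition function `Σ_{|w|=n, w admissible} exp (sup S_nψ|_{[w]})`
(in `ℝ≥0∞`; the supremum of `exp ∘ S_nψ` over the cylinder equals
`exp (sup S_nψ)`, with the empty supremum equal to `0 = e^{-∞}`). -/
noncomputable def partFn (A : E → E → Bool) (ψ : EA A → ℝ) (n : ℕ) : ℝ≥0∞ :=
  ∑' w : {w : List E // w.length = n ∧ IsAdmissibleList A w},
    ⨆ τ : cylList A w.1, ENNReal.ofReal (Real.exp (birk A ψ n τ.1))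

/-- Topological pressure of `ψ` on the two-sided shift space: the limit (here:
`limsup`, the limit exists by subadditivity) of `(1/n) log` of partition functions. -/
noncomputable def pressure (A : E → E → Bool) (ψ : EA A → ℝ) : EReal :=
  Filter.limsup (fun n : ℕ => (((n : ℝ)⁻¹ : ℝ) : EReal) * elog (partFn A ψ n)) Filter.atTop

noncomputable def partFnPlus (A : E → E → Bool) (ψ : EAplus A → ℝ) (n : ℕ) : ℝ≥0∞ :=
  ∑' w : {w : List E // w.length = n ∧ IsAdmissibleList A w},
    ⨆ τ : cylListPlus A w.1, ENNReal.ofReal (Real.exp (birkPlus A ψ n τ.1))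

/-- Topological pressure on the one-sided shift space. -/
noncomputable def pressurePlus (A : E → E → Bool) (ψ : EAplus A → ℝ) : EReal :=
  Filter.limsup (fun n : ℕ => (((n : ℝ)⁻¹ : ℝ) : EReal) * elog (partFnPlus A ψ n)) Filter.atTop

/-- The cylinder `[e] = {ω : ω₀ = e}`. -/
def cylE (A : E → E → Bool) (e : E) : Set (EA A) := {τ | τ.1 0 = e}

/-- `ψ` is summable: `Σ_{e∈E} exp (sup ψ|_{[e]}) < +∞`. -/
def SummablePot (A : E → E → Bool) (ψ : EA A → ℝ) : Prop :=
  (∑' e : E, ⨆ τ : cylE A e, ENNReal.ofReal (Real.exp (ψ τ.1))) ≠ ⊤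

/-- The cylinder `[ω|₀^{n-1}]`. -/
def cylOf (A : E → E → Bool) (ω : EA A) (n : ℕ) : Set (EA A) :=
  {τ | ∀ k : ℕ, k < n → τ.1 (k : ℤ) = ω.1 (k : ℤ)}

/-- `μ` is a Gibbs state of `ψ`: it is a `σ`-invariant Borel probability measure and
there are `C ≥ 1`, `P ∈ ℝ` with
`C⁻¹ ≤ μ([ω|₀^{n-1}]) / exp (S_nψ(ω) - Pn) ≤ C` for all `n ≥ 1`, `ω ∈ E_A`. -/
def IsGibbs [MeasurableSpace E] (A : E → E → Bool) (ψ : EA A → ℝ)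
    (μ : Measure (EA A)) : Prop :=
  IsProbabilityMeasure μ ∧ μ.map (shift A) = μ ∧
    ∃ C P : ℝ, 1 ≤ C ∧ ∀ n : ℕ, 1 ≤ n → ∀ ω : EA A,
      ENNReal.ofReal (C⁻¹ * Real.exp (birk A ψ n ω - P * n)) ≤ μ (cylOf A ω n) ∧
      μ (cylOf A ω n) ≤ ENNReal.ofReal (C * Real.exp (birk A ψ n ω - P * n))

/-- A (global) system of conditional measures of `μ` with respect to the partition
of `E_A` into the fibers of `π₁ : E_A → E_A^+`. -/
def IsCondSystem [MeasurableSpace E] (A : E → E → Bool) (μ : Measure (EA A))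
    (ν : EAplus A → Measure (EA A)) : Prop :=
  (∀ ω, IsProbabilityMeasure (ν ω)) ∧
  (∀ ω : EAplus A, ν ω {τ : EA A | proj1 A τ = ω} = 1) ∧
  (∀ s : Set (EA A), MeasurableSet s → μ s = ∫⁻ ω, ν ω s ∂(μ.map (proj1 A)))

/-- The truncation `τ|_{-n}^{+∞}` of a two-sided sequence, as a one-sided sequence. -/
def tail (A : E → E → Bool) (τ : EA A) (n : ℕ) : EAplus A :=
  ⟨fun k => τ.1 ((k : ℤ) - (n : ℤ)), fun k => by
    have h := τ.2 ((k : ℤ) - (n : ℤ))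
    have e : (((k + 1 : ℕ) : ℤ)) - (n : ℤ) = ((k : ℤ) - (n : ℤ)) + 1 := by push_cast; ring
    show A (τ.1 ((k : ℤ) - (n : ℤ))) (τ.1 (((k + 1 : ℕ) : ℤ) - (n : ℤ))) = true
    rw [e]; exact h⟩

/-- The concatenation `eω` of a letter `e` with `ω ∈ E_A^+` (given `A e ω₀ = 1`). -/
def cons (A : E → E → Bool) (e : E) (ω : EAplus A) (h : A e (ω.1 0) = true) : EAplus A :=
  ⟨fun k => Nat.rec (motive := fun _ => E) e (fun m _ => ω.1 m) k, fun k => by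
    cases k with
    | zero => exact h
    | succ m => exact ω.2 m⟩

variable {Y : Type*}

/-- `T_τ^n = T_{τ|_{-1}^{+∞}} ∘ T_{τ|_{-2}^{+∞}} ∘ … ∘ T_{τ|_{-n}^{+∞}}`. -/
def Tcomp (A : E → E → Bool) (T : EAplus A → Y → Y) (τ : EA A) : ℕ → Y → Y
  | 0 => id
  | n + 1 => Tcomp A T τ n ∘ T (tail A τ (n + 1))

/-- `T_η^m = T_{σ^{m-1}η} ∘ … ∘ T_{ση} ∘ T_η` for `η ∈ E_A^+`. -/
def TcompPlus (A : E → E → Bool) (T : EAplus A → Y → Y) : EAplus A → ℕ → Y → Y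
  | _, 0 => id
  | η, m + 1 => TcompPlus A T (shiftPlus A η) m ∘ T η



/-! ### Restricted pressure and past cylinders -/

/-- Partition function of `ψ` restricted to the subshift `F_A ⊆ E_A` over a finite
subalphabet `F`. -/
noncomputable def partFnF (A : E → E → Bool) (F : Finset E) (ψ : EA A → ℝ) (n : ℕ) : ℝ≥0∞ :=
  ∑' w : {w : List E // w.length = n ∧ IsAdmissibleList A w ∧ ∀ e ∈ w, e ∈ F},
    ⨆ τ : ↥(cylList A w.1 ∩ {τ : EA A | ∀ k : ℤ, τ.1 k ∈ F}),
      ENNReal.ofReal (Real.exp (birk A ψ n τ.1))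

/-- Topological pressure `P_F(ψ)` of `ψ|_{F_A}` with respect to the shift on the
subshift over the finite subalphabet `F` (equal to `⊥` if `F_A = ∅`). -/
noncomputable def pressureF (A : E → E → Bool) (F : Finset E) (ψ : EA A → ℝ) : EReal :=
  Filter.limsup (fun n : ℕ => (((n : ℝ)⁻¹ : ℝ) : EReal) * elog (partFnF A F ψ n)) Filter.atTop

/-- The matrix `A` restricted to `F × F` is irreducible. -/
def IrredOn (A : E → E → Bool) (F : Finset E) : Prop :=
  ∀ a ∈ F, ∀ b ∈ F, ∃ w : List E, (∀ e ∈ w, e ∈ F) ∧ IsAdmissibleList A (a :: (w ++ [b]))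

/-- The cylinder `[τω] ⊆ E_A`: sequences whose nonnegative part is `ω` and whose
coordinates `-n ≤ k ≤ -1` are given by the word `w` (with `w.get i` at coordinate
`i - n`, `n = |w|`). -/
def cylPast (A : E → E → Bool) (w : List E) (ω : EAplus A) : Set (EA A) :=
  {γ | proj1 A γ = ω ∧ ∀ k : Fin w.length, γ.1 (((k : ℕ) : ℤ) - (w.length : ℤ)) = w.get k}

/-! ### Conformal skew product Smale endomorphisms -/

/-- A conformal skew product Smale endomorphism, i.e. a skew product Smale
endomorphism satisfying conditions (a)–(g) of Section 5 of the paper, with fibers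
in `ℝ^d`. The projection `π̂₂` is part of the data, characterized by the field `hpi2`. -/
structure CSS [MeasurableSpace E] (A : E → E → Bool) (d : ℕ) where
  /-- The fiber sets `Y_ω`. -/
  Yset : EAplus A → Set (EuclideanSpace ℝ (Fin d))
  /-- The open neighborhoods `Y_ω^*` of the sets `Y_ω`. -/
  Ystar : EAplus A → Set (EuclideanSpace ℝ (Fin d))
  /-- The fiber maps `T_ω` (together with their conformal extensions to `Y_ω^*`). -/
  T : EAplus A → EuclideanSpace ℝ (Fin d) → EuclideanSpace ℝ (Fin d)
  /-- The projection `π̂₂ : E_A → ℝ^d`. -/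
  pi2 : EA A → EuclideanSpace ℝ (Fin d)
  lam : ℝ
  Hc : ℝ
  alpha : ℝ
  hlam : 1 < lam
  hHc : 0 < Hc
  halpha : 0 < alpha
  hYclosed : ∀ ω, IsClosed (Yset ω)
  hYbdd : Bornology.IsBounded (⋃ ω, Yset ω)
  hYreg : ∀ ω, Yset ω = closure (interior (Yset ω))
  hstar_open : ∀ ω, IsOpen (Ystar ω)
  hstar_conn : ∀ ω, IsConnected (Ystar ω)
  hstar_bdd : ∀ ω, Bornology.IsBounded (Ystar ω)
  hYsub : ∀ ω, Yset ω ⊆ Ystar ω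
  hmapsY : ∀ ω, Set.MapsTo (T ω) (Yset ω) (Yset (shiftPlus A ω))
  hmapsStar : ∀ ω, Set.MapsTo (T ω) (Ystar ω) (Ystar (shiftPlus A ω))
  hinj : ∀ ω, Set.InjOn (T ω) (Ystar ω)
  hC1 : ∀ ω, ContDiffOn ℝ 1 (T ω) (Ystar ω)
  hconf : ∀ ω, ∀ y ∈ Ystar ω, ConformalAt (T ω) y
  hcontr : ∀ ω, ∀ y ∈ Ystar ω, ∀ z ∈ Ystar ω, dist (T ω y) (T ω z) ≤ lam⁻¹ * dist y z
  hdistort : ∀ ω, ∀ y ∈ Ystar ω, ∀ z ∈ Ystar ω,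
      |Real.log ‖fderiv ℝ (T ω) y‖ - Real.log ‖fderiv ℝ (T ω) z‖| ≤ Hc * ‖y - z‖ ^ alpha
  hpi2 : ∀ τ : EA A,
      (⋂ n : ℕ, closure (Tcomp A T τ (n + 1) '' Yset (tail A τ (n + 1)))) = {pi2 τ}
  hHolderDer : ∃ β C : ℝ, 0 < β ∧ 0 < C ∧ ∀ τ τ' : EA A,
      |Real.log ‖fderiv ℝ (T (proj1 A τ)) (pi2 τ)‖ -
        Real.log ‖fderiv ℝ (T (proj1 A τ')) (pi2 τ')‖| ≤ C * dist2 A β τ τ'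
  hOSC : ∀ (ω : EAplus A) (a b : E) (ha : A a (ω.1 0) = true) (hb : A b (ω.1 0) = true),
      a ≠ b →
      Disjoint (T (cons A a ω ha) '' interior (Yset (cons A a ω ha)))
        (T (cons A b ω hb) '' interior (Yset (cons A b ω hb)))
  hbdry : ∃ δ : EAplus A → ℝ, Measurable δ ∧ (∀ ω, 0 < δ ω) ∧
      ∀ ω, ((pi2 '' {τ : EA A | proj1 A τ = ω}) ∩
        (Yset ω \ Metric.cthickening (δ ω) (Yset ω)ᶜ)).Nonempty

namespace CSS

variable [MeasurableSpace E] {d : ℕ}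

/-- The fiber `J_ω = π̂₂([ω])`. -/
def J (S : CSS A d) (ω : EAplus A) : Set (EuclideanSpace ℝ (Fin d)) :=
  S.pi2 '' {τ : EA A | proj1 A τ = ω}

/-- The system is Hölder: the projection `π̂` is Hölder continuous. -/
def IsHolder (S : CSS A d) : Prop :=
  ∃ κ C θ : ℝ, 0 < κ ∧ 0 < C ∧ 0 < θ ∧
    ∀ τ τ' : EA A, dist (S.pi2 τ) (S.pi2 τ') ≤ C * dist2 A κ τ τ' ^ θ

/-- Uniform Geometry Condition: every `Y_ω` contains a ball of a fixed radius `R > 0`. -/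
def UGC (S : CSS A d) : Prop :=
  ∃ R : ℝ, 0 < R ∧ ∀ ω : EAplus A, ∃ ξ, Metric.ball ξ R ⊆ S.Yset ω

/-- The geometric potential `ψ_t ∘ π̂ : τ ↦ -t log |T'_{τ|₀^{+∞}} (π̂₂ τ)|`. -/
noncomputable def geomPot (S : CSS A d) (t : ℝ) : EA A → ℝ :=
  fun τ => -t * Real.log ‖fderiv ℝ (S.T (proj1 A τ)) (S.pi2 τ)‖

/-- The pressure function `t ↦ P(t) = P(ψ_t ∘ π̂)`. -/
noncomputable def P (S : CSS A d) (t : ℝ) : EReal := pressure A (S.geomPot t)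

/-- Bowen's parameter `B_T = inf {t ≥ 0 : P(t) ≤ 0}` (equal to `⊤` if there is no
such `t`). -/
noncomputable def bowen (S : CSS A d) : ℝ≥0∞ :=
  sInf {s : ℝ≥0∞ | ∃ t : ℝ, 0 ≤ t ∧ s = ENNReal.ofReal t ∧ S.P t ≤ 0}

end CSS

/-- `φ_{ω|_n} = φ_{ω_0} ∘ φ_{ω_1} ∘ … ∘ φ_{ω_{n-1}}`. -/
def compPhi {Y : Type*} (A : E → E → Bool) (φ : E → Y → Y) (ω : EAplus A) : ℕ → Y → Y
  | 0 => id
  | n + 1 => compPhi A φ ω n ∘ φ (ω.1 n)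

/-- A conformal graph directed Markov system (GDMS) with vertex set `V`,
countable edge set `E`, and phase space in `ℝ^d`; the coding map `π_S` is part
of the data, characterized by the field `hpiS`. -/
structure GDMS (V : Type*) (E : Type*) (d : ℕ) where
  ivx : E → V
  tvx : E → V
  A : E → E → Bool
  hA : ∀ a b : E, A a b = true → tvx b = ivx a
  X : V → Set (EuclideanSpace ℝ (Fin d))
  W : V → Set (EuclideanSpace ℝ (Fin d))
  φ : E → EuclideanSpace ℝ (Fin d) → EuclideanSpace ℝ (Fin d)
  lam : ℝ
  hlam : lam ∈ Set.Ioo (0 : ℝ) 1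
  hXcpt : ∀ v, IsCompact (X v)
  hXconn : ∀ v, IsConnected (X v)
  hXreg : ∀ v, X v = closure (interior (X v))
  hWopen : ∀ v, IsOpen (W v)
  hWconn : ∀ v, IsConnected (W v)
  hXW : ∀ v, X v ⊆ W v
  hmapsX : ∀ e, Set.MapsTo (φ e) (X (tvx e)) (X (ivx e))
  hmapsW : ∀ e, Set.MapsTo (φ e) (W (tvx e)) (W (ivx e))
  hinj : ∀ e, Set.InjOn (φ e) (W (tvx e))
  hconf : ∀ e, ∀ y ∈ W (tvx e), ConformalAt (φ e) y
  hC1 : ∀ e, ContDiffOn ℝ 1 (φ e) (W (tvx e))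
  hLip : ∀ e, ∀ y ∈ X (tvx e), ∀ z ∈ X (tvx e), dist (φ e y) (φ e z) ≤ lam * dist y z
  piS : EAplus A → EuclideanSpace ℝ (Fin d)
  hpiS : ∀ ω : EAplus A, (⋂ n : ℕ, compPhi A φ ω (n + 1) '' X (tvx (ω.1 n))) = {piS ω}

/-! ### The Gauss map, continued fractions and the natural extension -/

/-- The Gauss (continued fraction) map `G(x) = 1/x - ⌊1/x⌋`, `G 0 = 0`. -/
noncomputable def gauss (x : ℝ) : ℝ := if x = 0 then 0 else Int.fract x⁻¹

/-- The denominators `q_n(x)` of the convergents of the continued fraction expansion,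
via `q₀ = 1`, `q₁ = ⌊1/x⌋` and `q_{n+2} = ⌊1/G^{n+1}(x)⌋ q_{n+1} + q_n`. -/
noncomputable def qden : ℕ → ℝ → ℤ
  | 0, _ => 1
  | 1, x => ⌊x⁻¹⌋
  | (n + 2), x => ⌊(gauss^[n + 1] x)⁻¹⌋ * qden (n + 1) x + qden n x

/-- `V_n(x) = q_{n-1}(x)/q_n(x)`, with `V₀ = 0`. -/
noncomputable def Vpast (n : ℕ) (x : ℝ) : ℝ :=
  if n = 0 then 0 else (qden (n - 1) x : ℝ) / (qden n x : ℝ)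

/-- The natural extension of the Gauss map, `Ĝ(x,y) = (G x, 1/(⌊1/x⌋ + y))`. -/
noncomputable def gaussExt (p : ℝ × ℝ) : ℝ × ℝ :=
  (gauss p.1, ((⌊p.1⁻¹⌋ : ℝ) + p.2)⁻¹)



/-! ### Replacing the past of a two-sided sequence -/

lemma shift_iterate_apply (ω : EA A) (j : ℕ) (k : ℤ) :
    ((shift A)^[j] ω).1 k = ω.1 (k + j) := by
  induction j generalizing ω with
  | zero => simp
  | succ j ih =>
    rw [Function.iterate_succ_apply, ih]
    change ω.1 (k + j + 1) = _
    rw [Nat.cast_succ, add_assoc]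

/-- The sequence with the nonnegative coordinates of `ω` and the past of `ρ`. -/
def replacePast (ω ρ : EA A) (h : ρ.1 0 = ω.1 0) : EA A :=
  ⟨fun k => if 0 ≤ k then ω.1 k else ρ.1 k, fun k => by
    dsimp only
    rcases lt_trichotomy k (-1) with hk | rfl | hk
    · rw [if_neg (by omega), if_neg (by omega)]
      exact ρ.2 k
    · simpa [h] using ρ.2 (-1)
    · rw [if_pos (by omega), if_pos (by omega)]
      exact ω.2 k⟩

/-- A sequence passing through the letter `e` at time `0`, depending only on `e`. -/
noncomputable def pastRep (e : E) (h : ∃ ρ : EA A, ρ.1 0 = e) : EA A := h.choose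

lemma pastRep_apply_zero (e : E) (h : ∃ ρ : EA A, ρ.1 0 = e) : (pastRep e h).1 0 = e :=
  h.choose_spec

/-- `ω` with its past replaced by one depending only on the letter `ω₀`. -/
noncomputable def normPast (ω : EA A) : EA A :=
  replacePast ω (pastRep (ω.1 0) ⟨ω, rfl⟩) (pastRep_apply_zero _ _)

lemma normPast_apply_of_nonneg (ω : EA A) {k : ℤ} (hk : 0 ≤ k) :
    (normPast ω).1 k = ω.1 k :=
  if_pos hk

lemma normPast_apply_congr {ω τ : EA A} (h : ω.1 0 = τ.1 0) {k : ℤ}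
    (hk : 0 ≤ k → ω.1 k = τ.1 k) : (normPast ω).1 k = (normPast τ).1 k := by
  by_cases h0 : 0 ≤ k
  · rw [normPast_apply_of_nonneg _ h0, normPast_apply_of_nonneg _ h0, hk h0]
  · simp only [normPast, replacePast, if_neg h0, h]

lemma normPast_congr {ω τ : EA A} (h : ∀ k : ℤ, 0 ≤ k → ω.1 k = τ.1 k) :
    normPast ω = normPast τ :=
  Subtype.ext <| funext fun k => normPast_apply_congr (h 0 le_rfl) (h k)

lemma agreeTwo_normPast {ω τ : EA A} {n : ℕ} (h : agreeTwo ω τ n) :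
    agreeTwo (normPast ω) (normPast τ) n :=
  fun k hk => normPast_apply_congr (h 0 (by simp)) fun _ => h k hk

lemma agreeTwo_shift_iterate_of_nonneg {ω τ : EA A} (h : ∀ k : ℤ, 0 ≤ k → ω.1 k = τ.1 k)
    (j : ℕ) : agreeTwo ((shift A)^[j] ω) ((shift A)^[j] τ) j := by
  intro k hk
  rw [abs_le] at hk
  rw [shift_iterate_apply, shift_iterate_apply]
  exact h _ (by omega)

lemma agreeTwo_shift_iterate {ω τ : EA A} {n j : ℕ} (h : agreeTwo ω τ n) (hj : j ≤ n) :
    agreeTwo ((shift A)^[j] ω) ((shift A)^[j] τ) (n - j) := by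
  intro k hk
  rw [shift_iterate_apply, shift_iterate_apply]
  refine h _ ?_
  rw [abs_le] at hk ⊢
  omega

/-! ### The transfer function -/

lemma LocHolderTwo.abs_sub_le {β C : ℝ} {ψ : EA A → ℝ} (hψ : LocHolderTwo A β C ψ)
    {ω τ : EA A} {n : ℕ} (h : agreeTwo ω τ n) : |ψ ω - ψ τ| ≤ C * Real.exp (-β * n) :=
  hψ ω τ (h 0 (by simp)) n h

lemma summable_exp_neg_mul_nat {β : ℝ} (hβ : 0 < β) :
    Summable fun j : ℕ => Real.exp (-β * j) := by
  simpa only [mul_comm] using Real.summable_exp_nat_mul_iff.2 (neg_neg_of_pos hβ)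

lemma summable_exp_neg_mul_abs_int {β : ℝ} (hβ : 0 < β) :
    Summable fun k : ℤ => Real.exp (-β * |(k : ℝ)|) := by
  refine Summable.of_nat_of_neg ?_ ?_ <;> simpa using summable_exp_neg_mul_nat hβ

/-- The `j`-th term of the series defining the transfer function. -/
noncomputable def transferTerm (ψ : EA A → ℝ) (ω : EA A) (j : ℕ) : ℝ :=
  ψ ((shift A)^[j] ω) - ψ ((shift A)^[j] (normPast ω))

/-- The transfer function `∑ⱼ (ψ(σʲω) - ψ(σʲω̄))`, with `ω̄` the sequence `normPast ω`. -/
noncomputable def transfer (ψ : EA A → ℝ) (ω : EA A) : ℝ :=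
  ∑' j, transferTerm ψ ω j

section Bounds

variable {β C : ℝ} {ψ : EA A → ℝ}

lemma abs_transferTerm_le (hψ : LocHolderTwo A β C ψ) (ω : EA A) (j : ℕ) :
    |transferTerm ψ ω j| ≤ C * Real.exp (-β * j) :=
  hψ.abs_sub_le <| agreeTwo_shift_iterate_of_nonneg
    (fun _ hk => (normPast_apply_of_nonneg ω hk).symm) j

lemma summable_transferTerm (hβ : 0 < β) (hψ : LocHolderTwo A β C ψ) (ω : EA A) :
    Summable (transferTerm ψ ω) :=
  .of_norm_bounded ((summable_exp_neg_mul_nat hβ).mul_left C) (abs_transferTerm_le hψ ω)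

lemma abs_transfer_le (hβ : 0 < β) (hψ : LocHolderTwo A β C ψ) (ω : EA A) :
    |transfer ψ ω| ≤ C * ∑' j : ℕ, Real.exp (-β * j) :=
  tsum_of_norm_bounded (f := transferTerm ψ ω)
    ((summable_exp_neg_mul_nat hβ).hasSum.mul_left C) (abs_transferTerm_le hψ ω)

lemma abs_transferTerm_sub_le (hβ : 0 < β) (hC : 0 ≤ C) (hψ : LocHolderTwo A β C ψ)
    {ω τ : EA A} {n : ℕ} (h : agreeTwo ω τ n) (j : ℕ) :
    |transferTerm ψ ω j - transferTerm ψ τ j| ≤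
      2 * C * Real.exp (β / 2) * Real.exp (-(β / 2) * n) *
        Real.exp (-β * |(j : ℝ) - (n / 2 : ℕ)|) := by
  rw [mul_assoc, mul_assoc, ← Real.exp_add, ← Real.exp_add]
  have hn : (n : ℝ) ≤ 2 * (n / 2 : ℕ) + 1 := by exact_mod_cast (by omega : n ≤ 2 * (n / 2) + 1)
  have hn' : 2 * ((n / 2 : ℕ) : ℝ) ≤ n := by exact_mod_cast (by omega : 2 * (n / 2) ≤ n)
  rcases le_or_gt j (n / 2) with hj | hj
  · have hjn : j ≤ n := by omega
    have h₁ := hψ.abs_sub_le (agreeTwo_shift_iterate h hjn)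
    have h₂ := hψ.abs_sub_le (agreeTwo_shift_iterate (agreeTwo_normPast h) hjn)
    have hj' : (j : ℝ) ≤ (n / 2 : ℕ) := by exact_mod_cast hj
    calc |transferTerm ψ ω j - transferTerm ψ τ j|
        = |(ψ ((shift A)^[j] ω) - ψ ((shift A)^[j] τ)) -
            (ψ ((shift A)^[j] (normPast ω)) - ψ ((shift A)^[j] (normPast τ)))| := by
          unfold transferTerm; congr 1; ring
      _ ≤ 2 * C * Real.exp (-β * (n - j : ℕ)) := (abs_sub _ _).trans (by linarith)
      _ ≤ _ := by
          gcongr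
          rw [abs_of_nonpos (by linarith), Nat.cast_sub hjn]
          nlinarith
  · have hj' : ((n / 2 : ℕ) : ℝ) ≤ j := by exact_mod_cast hj.le
    have h₁ := abs_transferTerm_le hψ ω j
    have h₂ := abs_transferTerm_le hψ τ j
    calc |transferTerm ψ ω j - transferTerm ψ τ j|
        ≤ 2 * C * Real.exp (-β * j) := (abs_sub _ _).trans (by linarith)
      _ ≤ _ := by
          gcongr
          rw [abs_of_nonneg (by linarith)]
          nlinarith

lemma abs_transfer_sub_le (hβ : 0 < β) (hC : 0 ≤ C) (hψ : LocHolderTwo A β C ψ)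
    {ω τ : EA A} {n : ℕ} (h : agreeTwo ω τ n) :
    |transfer ψ ω - transfer ψ τ| ≤
      2 * C * Real.exp (β / 2) * (∑' k : ℤ, Real.exp (-β * |(k : ℝ)|)) *
        Real.exp (-(β / 2) * n) := by
  have hinj : Function.Injective fun j : ℕ => (j : ℤ) - (n / 2 : ℕ) := fun i j hij => by
    simpa using hij
  have hsum := summable_exp_neg_mul_abs_int hβ
  rw [transfer, transfer,
    ← (summable_transferTerm hβ hψ ω).tsum_sub (summable_transferTerm hβ hψ τ)]
  refine (tsum_of_norm_bounded (f := fun j => transferTerm ψ ω j - transferTerm ψ τ j)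
    ((hsum.comp_injective hinj).hasSum.mul_left
    (2 * C * Real.exp (β / 2) * Real.exp (-(β / 2) * n))) fun j => ?_).trans ?_
  · simpa only [Function.comp_apply, Real.norm_eq_abs, Int.cast_sub, Int.cast_natCast] using
      abs_transferTerm_sub_le hβ hC hψ h j
  · rw [mul_right_comm]
    gcongr
    exact tsum_comp_le_tsum_of_inj hsum (fun _ => (Real.exp_pos _).le) hinj

/-- For sequences with equal nonnegative coordinates the coboundary telescopes. -/
lemma transfer_sub_transfer_of_nonneg (hβ : 0 < β) (hψ : LocHolderTwo A β C ψ) {ω τ : EA A}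
    (h : ∀ k : ℤ, 0 ≤ k → ω.1 k = τ.1 k) :
    transfer ψ ω - transfer ψ τ =
      ψ ω - ψ τ + (transfer ψ (shift A ω) - transfer ψ (shift A τ)) := by
  have hs : ∀ k : ℤ, 0 ≤ k → (shift A ω).1 k = (shift A τ).1 k := fun k hk => h _ (by omega)
  have hsum := (summable_transferTerm hβ hψ ω).sub (summable_transferTerm hβ hψ τ)
  simp only [transfer]
  rw [← (summable_transferTerm hβ hψ ω).tsum_sub (summable_transferTerm hβ hψ τ),
    ← (summable_transferTerm hβ hψ _).tsum_sub (summable_transferTerm hβ hψ _),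
    hsum.tsum_eq_zero_add]
  simp [transferTerm, normPast_congr h, normPast_congr hs]

end Bounds

lemma le_mul_dist2 {β L x : ℝ} {ω τ : EA A} (hL : 0 ≤ L) (hx : x ≤ L * Real.exp β)
    (h : ∀ n : ℕ, agreeTwo ω τ n → x ≤ L * Real.exp (-β * n)) : x ≤ L * dist2 A β ω τ := by
  rw [dist2, Real.mul_iInf_of_nonneg hL]
  refine le_ciInf fun n => ?_
  split_ifs with hn
  · exact h n hn
  · exact hx

/-- every locally Hölder continuous `ψ : E_A → ℝ` is cohomologous, via a
bounded coboundary Lipschitz with respect to `d_{β/2}`, to a past-independent locally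
Hölder continuous function `ψ⁺ = ψ - u + u∘σ`. -/
theorem statement0 [Countable E] {A : E → E → Bool} (hA : FinitelyIrreducible A)
    (β C : ℝ) (hβ : 0 < β) (hC : 0 < C) (ψ : EA A → ℝ) (hψ : LocHolderTwo A β C ψ) :
    ∃ u : EA A → ℝ,
      (∃ M : ℝ, ∀ ω : EA A, |u ω| ≤ M) ∧
      (∃ L : ℝ, 0 ≤ L ∧ ∀ ω τ : EA A, |u ω - u τ| ≤ L * dist2 A (β / 2) ω τ) ∧
      LocallyHolderTwo A (fun ω => ψ ω - u ω + u (shift A ω)) ∧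
      (∀ ω τ : EA A, (∀ k : ℕ, ω.1 (k : ℤ) = τ.1 (k : ℤ)) →
        ψ ω - u ω + u (shift A ω) = ψ τ - u τ + u (shift A τ)) := by
  set M := C * ∑' j : ℕ, Real.exp (-β * j)
  set D := 2 * C * Real.exp (β / 2) * ∑' k : ℤ, Real.exp (-β * |(k : ℝ)|)
  have hM : 0 ≤ M := mul_nonneg hC.le (tsum_nonneg fun _ => (Real.exp_pos _).le)
  have hD : 0 ≤ D := mul_nonneg (by positivity) (tsum_nonneg fun _ => (Real.exp_pos _).le)
  have hbdd (ω τ : EA A) : |transfer ψ ω - transfer ψ τ| ≤ (2 * M + D) * Real.exp (β / 2) := by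
    have h₁ := abs_transfer_le hβ hψ ω
    have h₂ := abs_transfer_le hβ hψ τ
    have h₃ : |transfer ψ ω - transfer ψ τ| ≤ 2 * M + D := (abs_sub _ _).trans (by linarith)
    exact h₃.trans (le_mul_of_one_le_right (by positivity) (Real.one_le_exp (by positivity)))
  have hlip {ω τ : EA A} {n : ℕ} (h : agreeTwo ω τ n) :
      |transfer ψ ω - transfer ψ τ| ≤ (2 * M + D) * Real.exp (-(β / 2) * n) :=
    (abs_transfer_sub_le hβ hC.le hψ h).trans (by gcongr; linarith)
  refine ⟨transfer ψ, ⟨M, abs_transfer_le hβ hψ⟩, ⟨2 * M + D, by positivity, fun ω τ =>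
    le_mul_dist2 (by positivity) (hbdd ω τ) fun n => hlip⟩, ?_, fun ω τ h => ?_⟩
  · refine ⟨β / 2, C + (2 * M + D) + (2 * M + D) * Real.exp (β / 2), by positivity,
      by positivity, fun ω τ _ n h => ?_⟩
    have h₁ : |ψ ω - ψ τ| ≤ C * Real.exp (-(β / 2) * n) :=
      (hψ.abs_sub_le h).trans (by gcongr; linarith)
    have h₂ := hlip h
    have h₃ : |transfer ψ (shift A ω) - transfer ψ (shift A τ)| ≤
        (2 * M + D) * Real.exp (β / 2) * Real.exp (-(β / 2) * n) := by
      cases n with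
      | zero => simpa using hbdd (shift A ω) (shift A τ)
      | succ n =>
        refine (hlip (agreeTwo_shift_iterate (j := 1) h (by omega))).trans_eq ?_
        rw [mul_assoc, ← Real.exp_add]
        congr 2
        push_cast [Nat.add_sub_cancel]
        ring
    rw [abs_le] at *
    constructor <;> linarith
  · have := transfer_sub_transfer_of_nonneg hβ hψ (ω := ω) (τ := τ) fun k hk => by
      lift k to ℕ using hk
      exact h k
    linarith

end Paper
end

section
/- A locally Hölder continuous potential ψ : E_A → ℝ is summable if and only if its topological pressure is finite: Σ_{e∈E} exp(sup ψ|_{[e]}) < +∞ if and only if P(ψ) < +∞. -/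
open MeasureTheory Filter Set Topology

open scoped ENNReal Classical

namespace Paper

variable {E : Type*}

variable {A : E → E → Bool}

variable {Y : Type*}

lemma coe_shift_iterate (j : ℕ) (τ : EA A) (k : ℤ) :
    ((shift A)^[j] τ).1 k = τ.1 (k + j) := by
  induction j generalizing τ with
  | zero => simp
  | succ j ih =>
    rw [Function.iterate_succ_apply, ih]
    show τ.1 (k + j + 1) = _
    push_cast
    rw [add_assoc]

lemma tsum_prod_fin_eq_pow {α : Type*} (g : α → ℝ≥0∞) (n : ℕ) :
    ∑' v : Fin n → α, ∏ i, g (v i) = (∑' a, g a) ^ n := by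
  induction n with
  | zero =>
    rw [tsum_eq_single (default : Fin 0 → α) fun b hb => (hb (Subsingleton.elim _ _)).elim]
    simp
  | succ n ih =>
    rw [← (Fin.consEquiv fun _ : Fin (n + 1) => α).tsum_eq, ENNReal.tsum_prod']
    simp only [Fin.consEquiv_apply, Fin.prod_univ_succ, Fin.cons_zero, Fin.cons_succ]
    simp_rw [ENNReal.tsum_mul_left, ih, ENNReal.tsum_mul_right]
    rw [pow_succ']

lemma partFn_le_pow (ψ : EA A → ℝ) (n : ℕ) :
    partFn A ψ n ≤
      (∑' e : E, ⨆ τ : cylE A e, ENNReal.ofReal (Real.exp (ψ τ.1))) ^ n := by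
  rw [← tsum_prod_fin_eq_pow]
  have hinj : Function.Injective
      (fun (w : {w : List E // w.length = n ∧ IsAdmissibleList A w}) (i : Fin n) =>
        w.1.get (i.cast w.2.1.symm)) := by
    rintro ⟨w, hw, hw'⟩ ⟨v, hv, hv'⟩ h
    refine Subtype.ext (List.ext_get (hw.trans hv.symm) fun i h₁ h₂ => ?_)
    exact congrFun h ⟨i, hw ▸ h₁⟩
  refine le_trans ?_ (ENNReal.tsum_comp_le_tsum_of_injective hinj _)
  refine ENNReal.tsum_le_tsum fun w => iSup_le fun τ => ?_
  rw [birk, Real.exp_sum, ENNReal.ofReal_prod_of_nonneg fun _ _ => (Real.exp_pos _).le,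
    Finset.prod_range]
  refine Finset.prod_le_prod' fun i _ => ?_
  refine le_iSup_of_le (⟨(shift A)^[i] τ.1, ?_⟩ : cylE A _) le_rfl
  have := τ.2 (i.cast w.2.1.symm)
  simpa [cylE, coe_shift_iterate] using this

lemma elog_le_of_le_pow {x : ℝ≥0∞} {K : ℝ} {n : ℕ}
    (h : x ≤ ENNReal.ofReal (Real.exp K) ^ n) : elog x ≤ ((n * K : ℝ) : EReal) := by
  have hx : x ≠ ⊤ := ne_top_of_le_ne_top (ENNReal.pow_ne_top ENNReal.ofReal_ne_top) h
  unfold elog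
  split_ifs with h0
  · exact bot_le
  · rw [EReal.coe_le_coe_iff, Real.log_le_iff_le_exp (ENNReal.toReal_pos h0 hx), Real.exp_nat_mul]
    rw [← ENNReal.ofReal_pow (Real.exp_pos _).le] at h
    exact ENNReal.toReal_le_of_le_ofReal (by positivity) h

lemma pressure_lt_top_of_summablePot {ψ : EA A → ℝ} (h : SummablePot A ψ) :
    pressure A ψ < ⊤ := by
  set M := ∑' e : E, ⨆ τ : cylE A e, ENNReal.ofReal (Real.exp (ψ τ.1)) with hM
  obtain ⟨K, hK⟩ : ∃ K : ℝ, M ≤ ENNReal.ofReal (Real.exp K) :=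
    ⟨M.toReal, (ENNReal.ofReal_toReal h).symm.le.trans
      (ENNReal.ofReal_le_ofReal (by linarith [Real.add_one_le_exp M.toReal]))⟩
  refine lt_of_le_of_lt (b := (K : EReal)) (limsup_le_of_le (h := ?_)) (EReal.coe_lt_top K)
  filter_upwards [eventually_gt_atTop 0] with n hn
  have hn' : (0 : ℝ) < n := by exact_mod_cast hn
  calc (((n : ℝ)⁻¹ : ℝ) : EReal) * elog (partFn A ψ n)
      ≤ (((n : ℝ)⁻¹ : ℝ) : EReal) * ((n * K : ℝ) : EReal) :=
        mul_le_mul_of_nonneg_left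
          (elog_le_of_le_pow ((partFn_le_pow ψ n).trans (pow_le_pow_left' hK n)))
          (by exact_mod_cast (inv_pos.2 hn').le)
    _ = K := by
        rw [← EReal.coe_mul, inv_mul_cancel_left₀ hn'.ne']

lemma exists_partFn_ne_top_of_pressure_lt_top {ψ : EA A → ℝ} (h : pressure A ψ < ⊤) :
    ∃ n, 0 < n ∧ partFn A ψ n ≠ ⊤ := by
  obtain ⟨n, hn, hlt⟩ := ((eventually_gt_atTop 0).and (eventually_lt_of_limsup_lt h)).exists
  refine ⟨n, hn, fun htop => hlt.ne ?_⟩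
  have hn' : (0 : ℝ) < (n : ℝ)⁻¹ := by positivity
  rw [htop, elog, if_neg ENNReal.top_ne_zero, if_pos rfl, EReal.coe_mul_top_of_pos hn']

/-- Every letter has a successor inside a fixed finite set of letters. -/
lemma FinitelyIrreducible.exists_finset_successor [Nonempty E] (hA : FinitelyIrreducible A) :
    ∃ F : Finset E, ∀ x, ∃ y ∈ F, A x y = true := by
  obtain ⟨Λ, -, hΛ⟩ := hA
  obtain ⟨a⟩ := ‹Nonempty E›
  refine ⟨insert a (Λ.biUnion List.toFinset), fun x => ?_⟩
  obtain ⟨γ, hγ, hadm⟩ := hΛ x a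
  replace hadm : List.IsChain (fun c d => A c d = true) (x :: (γ ++ [a])) := hadm
  cases γ with
  | nil => exact ⟨a, by simp, by simpa using hadm⟩
  | cons b γ =>
    refine ⟨b, Finset.mem_insert_of_mem (Finset.mem_biUnion.2 ⟨_, hγ, by simp⟩), ?_⟩
    rw [List.cons_append, List.isChain_cons_cons] at hadm
    exact hadm.1

/-- A locally Hölder potential is bounded below on finitely many initial cylinders. -/
lemma LocallyHolderTwo.exists_le_of_mem_finset {ψ : EA A → ℝ} (hψ : LocallyHolderTwo A ψ)
    (F : Finset E) : ∃ K : ℝ, ∀ τ : EA A, τ.1 0 ∈ F → K ≤ ψ τ := by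
  obtain ⟨β, C, -, -, h⟩ := hψ
  induction F using Finset.induction_on with
  | empty => exact ⟨0, by simp⟩
  | insert f F _ ih =>
    obtain ⟨K, hK⟩ := ih
    by_cases hf : ∃ τ : EA A, τ.1 0 = f
    · obtain ⟨τ₀, hτ₀⟩ := hf
      refine ⟨min K (ψ τ₀ - C), fun τ hτ => ?_⟩
      rcases Finset.mem_insert.1 hτ with hτ | hτ
      · refine (min_le_right _ _).trans ?_
        have h0 : τ.1 0 = τ₀.1 0 := hτ.trans hτ₀.symm
        have := h τ τ₀ h0 0 fun k hk => by
          obtain rfl : k = 0 := by simpa using hk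
          exact h0
        simp only [Nat.cast_zero, mul_zero, Real.exp_zero, mul_one] at this
        linarith [(abs_le.1 this).1]
      · exact (min_le_left _ _).trans (hK τ hτ)
    · exact ⟨K, fun τ hτ => hK τ ((Finset.mem_insert.1 hτ).resolve_left fun hτ => hf ⟨τ, hτ⟩)⟩

/-- The sequence with the past of `τ` and whose future is the orbit of `τ₀` under `s`. -/
def graftOrbit (s : E → E) (hs : ∀ x, A x (s x) = true) (τ : EA A) : EA A :=
  ⟨fun k => if k ≤ 0 then τ.1 k else s^[k.toNat] (τ.1 0), fun k => by
    beta_reduce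
    rcases lt_trichotomy k (-1) with hk | rfl | hk
    · rw [if_pos (by omega), if_pos (by omega)]
      exact τ.2 k
    · simpa using τ.2 (-1)
    · obtain ⟨m, rfl⟩ : ∃ m : ℕ, k = m := ⟨k.toNat, by omega⟩
      have h1 : ((m : ℤ) + 1).toNat = m + 1 := by omega
      rw [if_neg (by omega : ¬ ((m : ℤ) + 1 ≤ 0)), h1, Function.iterate_succ_apply']
      split_ifs with h
      · obtain rfl : m = 0 := by omega
        exact hs _
      · exact hs _⟩

lemma graftOrbit_natCast (s : E → E) (hs : ∀ x, A x (s x) = true) (τ : EA A) (m : ℕ) :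
    (graftOrbit s hs τ).1 m = s^[m] (τ.1 0) := by
  cases m with
  | zero => simp [graftOrbit]
  | succ m =>
    have h : ¬ (((m + 1 : ℕ) : ℤ) ≤ 0) := by omega
    simp only [graftOrbit, if_neg h, Int.toNat_natCast]

lemma summablePot_of_partFn_ne_top (hA : FinitelyIrreducible A) {ψ : EA A → ℝ}
    (hψ : LocallyHolderTwo A ψ) {n : ℕ} (hn : 0 < n) (h : partFn A ψ n ≠ ⊤) :
    SummablePot A ψ := by
  unfold SummablePot
  rcases isEmpty_or_nonempty E with _ | _
  · simp
  obtain ⟨F, hF⟩ := hA.exists_finset_successor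
  choose s hsF hs using hF
  obtain ⟨K, hK⟩ := hψ.exists_le_of_mem_finset F
  obtain ⟨β, C, -, -, hC⟩ := hψ
  obtain ⟨m, rfl⟩ : ∃ m, n = m + 1 := ⟨n - 1, by omega⟩
  let W : E → {w : List E // w.length = m + 1 ∧ IsAdmissibleList A w} := fun e =>
    ⟨List.ofFn fun i : Fin (m + 1) => s^[i] e, by simp, by
      unfold IsAdmissibleList
      refine List.isChain_iff_getElem.2 fun i hi => ?_
      simp only [List.getElem_ofFn, Function.iterate_succ_apply']
      exact hs _⟩
  have hW : Function.Injective W := fun a b hab => by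
    have := congrArg (fun w => w.1.head?) hab
    simpa [W] using this
  have hbirk (τ : EA A) : ψ τ - C + m * K ≤ birk A ψ (m + 1) (graftOrbit s hs τ) := by
    rw [birk, Finset.sum_range_succ', Function.iterate_zero_apply, add_comm]
    refine add_le_add ?_ ?_
    · calc (m : ℝ) * K = ∑ _j ∈ Finset.range m, K := by simp
        _ ≤ _ := Finset.sum_le_sum fun j _ => hK _ <| by
          rw [coe_shift_iterate, zero_add, graftOrbit_natCast, Function.iterate_succ_apply']
          exact hsF _
    · have h0 : τ.1 0 = (graftOrbit s hs τ).1 0 := by simp [graftOrbit]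
      have := hC τ _ h0 0 fun k hk => by
        obtain rfl : k = 0 := by simpa using hk
        exact h0
      simp only [Nat.cast_zero, mul_zero, Real.exp_zero, mul_one] at this
      linarith [(abs_le.1 this).2]
  have key : (∑' e : E, ⨆ τ : cylE A e, ENNReal.ofReal (Real.exp (ψ τ.1))) ≤
      ENNReal.ofReal (Real.exp (C - m * K)) * partFn A ψ (m + 1) := by
    refine le_trans ?_ (mul_le_mul_right (ENNReal.tsum_comp_le_tsum_of_injective hW _) _)
    rw [← ENNReal.tsum_mul_left]
    refine ENNReal.tsum_le_tsum fun e => iSup_le fun τ => ?_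
    have hmem : graftOrbit s hs τ.1 ∈ cylList A (W e).1 := fun k => by
      rw [graftOrbit_natCast, show τ.1.1 0 = e from τ.2]
      simp only [W, List.get_eq_getElem, List.getElem_ofFn]
    calc ENNReal.ofReal (Real.exp (ψ τ.1))
        ≤ ENNReal.ofReal (Real.exp (C - m * K)) *
            ENNReal.ofReal (Real.exp (birk A ψ (m + 1) (graftOrbit s hs τ.1))) := by
          rw [← ENNReal.ofReal_mul (Real.exp_pos _).le, ← Real.exp_add]
          exact ENNReal.ofReal_le_ofReal (Real.exp_le_exp.2 (by linarith [hbirk τ.1]))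
      _ ≤ _ := by
          gcongr
          exact le_iSup (fun σ : cylList A (W e).1 =>
            ENNReal.ofReal (Real.exp (birk A ψ (m + 1) σ.1))) ⟨_, hmem⟩
  exact ne_top_of_le_ne_top (ENNReal.mul_ne_top ENNReal.ofReal_ne_top h) key

/-- a locally Hölder continuous potential is summable iff its pressure is
finite. -/
theorem statement3 [Countable E] {A : E → E → Bool} (hA : FinitelyIrreducible A)
    (ψ : EA A → ℝ) (hψ : LocallyHolderTwo A ψ) :
    SummablePot A ψ ↔ pressure A ψ < ⊤ := by
  refine ⟨pressure_lt_top_of_summablePot, fun h => ?_⟩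
  obtain ⟨n, hn, hfin⟩ := exists_partFn_ne_top_of_pressure_lt_top h
  exact summablePot_of_partFn_ne_top hA hψ hn hfin

end Paper
end

section
/- Every skew product Smale system of global character is Hölder: there exist a constant C′ > 0 and an exponent θ > 0 such that d(π̂₂(α), π̂₂(β)) ≤ C′ (d_κ(α,β))^θ for all α, β ∈ E_A; consequently the projection π̂ : E_A → E_A^+ × Y is Hölder continuous, and the induced map T : J → J is continuous. -/
open MeasureTheory Filter Set Topology

open scoped ENNReal Classical

namespace Paper

variable {E : Type*}

variable {A : E → E → Bool}

variable {Y : Type*}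

lemma dist1_le_of_agreePlus {κ : ℝ} {ω τ : EAplus A} {n : ℕ} (h : agreePlus ω τ n) :
    dist1 A κ ω τ ≤ Real.exp (-κ * n) := by
  have hb : BddBelow (Set.range fun n : ℕ =>
      if agreePlus ω τ n then Real.exp (-κ * n) else Real.exp κ) := by
    refine ⟨0, ?_⟩
    rintro _ ⟨m, rfl⟩
    dsimp only
    split_ifs <;> positivity
  simpa [dist1, h] using ciInf_le hb n

lemma agreePlus_tail {α β : EA A} {N m : ℕ} (h : agreeTwo α β N) (hm : m ≤ N) :
    agreePlus (tail A α m) (tail A β m) N := by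
  intro k hk
  exact h _ (abs_le.2 ⟨by omega, by omega⟩)

/-- Fiberwise contraction and the Hölder dependence of the fiber maps on the base point bound the
distance of the compositions along two sequences agreeing up to `N`. -/
lemma dist_Tcomp_le [PseudoMetricSpace Y] {T : EAplus A → Y → Y} {r C κ : ℝ} (hr : 0 ≤ r)
    (hC : 0 ≤ C)
    (hlip : ∀ ω : EAplus A, ∀ y z : Y, dist (T ω y) (T ω z) ≤ r * dist y z)
    (hdinf : ∀ α β : EAplus A, ∀ ξ : Y, dist (T α ξ) (T β ξ) ≤ C * dist1 A κ α β)
    {α β : EA A} {N : ℕ} (h : agreeTwo α β N) (n : ℕ) (hn : n ≤ N) (y z : Y) :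
    dist (Tcomp A T α n y) (Tcomp A T β n z) ≤
      r ^ n * dist y z + (∑ m ∈ Finset.range n, r ^ m) * (C * Real.exp (-κ * N)) := by
  induction n generalizing y z with
  | zero => simp [Tcomp]
  | succ n ih =>
    have hstep : dist (T (tail A α (n + 1)) y) (T (tail A β (n + 1)) z) ≤
        r * dist y z + C * Real.exp (-κ * N) :=
      calc _ ≤ _ := dist_triangle _ (T (tail A α (n + 1)) z) _
        _ ≤ _ := add_le_add (hlip _ _ _) ((hdinf _ _ _).trans
          (mul_le_mul_of_nonneg_left (dist1_le_of_agreePlus (agreePlus_tail h hn)) hC))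
    calc _ ≤ _ := ih (by omega) _ _
      _ ≤ r ^ n * (r * dist y z + C * Real.exp (-κ * N)) +
          (∑ m ∈ Finset.range n, r ^ m) * (C * Real.exp (-κ * N)) := by gcongr
      _ = _ := by rw [Finset.sum_range_succ]; ring

lemma dist_le_of_mem_closure_of_mem_closure [PseudoMetricSpace Y] {s t : Set Y} {B : ℝ}
    (h : ∀ x ∈ s, ∀ y ∈ t, dist x y ≤ B) {p q : Y} (hp : p ∈ closure s) (hq : q ∈ closure t) :
    dist p q ≤ B := by
  have hmem : (p, q) ∈ closure (s ×ˢ t) := by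
    rw [closure_prod_eq]
    exact ⟨hp, hq⟩
  exact closure_minimal (fun x hx => h x.1 hx.1 x.2 hx.2)
    (isClosed_le continuous_dist continuous_const) hmem

lemma mem_closure_Tcomp [TopologicalSpace Y] {T : EAplus A → Y → Y} {τ : EA A} {y : Y}
    (h : y ∈ ⋂ n : ℕ, closure (Tcomp A T τ (n + 1) '' (Set.univ : Set Y))) (n : ℕ) :
    y ∈ closure (Tcomp A T τ n '' (Set.univ : Set Y)) := by
  cases n with
  | zero => simp [Tcomp]
  | succ n => exact Set.mem_iInter.1 h n

lemma continuous_shiftPlus [TopologicalSpace E] : Continuous (shiftPlus A) :=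
  (continuous_pi fun n => (continuous_apply (n + 1)).comp continuous_subtype_val :
    Continuous fun (ω : EAplus A) (n : ℕ) => ω.1 (n + 1)).subtype_mk _

lemma eventually_agreePlus [TopologicalSpace E] [DiscreteTopology E] (ω : EAplus A) (n : ℕ) :
    ∀ᶠ τ in 𝓝 ω, agreePlus τ ω n := by
  have h : ∀ k : ℕ, ∀ᶠ τ : EAplus A in 𝓝 ω, τ.1 k = ω.1 k := fun k =>
    ((continuous_apply k).comp continuous_subtype_val).continuousAt.preimage_mem_nhds
      ((isOpen_discrete {ω.1 k}).mem_nhds rfl)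
  exact ((Set.finite_Iic n).eventually_all (l := 𝓝 ω) (p := fun k τ => τ.1 k = ω.1 k)).2
    fun k _ => h k

lemma tendsto_dist1 [TopologicalSpace E] [DiscreteTopology E] {κ : ℝ} (hκ : 0 < κ)
    (ω : EAplus A) : Tendsto (fun τ => dist1 A κ τ ω) (𝓝 ω) (𝓝 0) := by
  have hexp : Tendsto (fun n : ℕ => Real.exp (-κ * n)) atTop (𝓝 0) :=
    Real.tendsto_exp_atBot.comp
      (tendsto_natCast_atTop_atTop.const_mul_atTop_of_neg (neg_lt_zero.2 hκ))
  refine tendsto_order.2 ⟨fun a ha => Eventually.of_forall fun τ => ha.trans_le ?_,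
    fun ε hε => ?_⟩
  · refine le_ciInf fun n => ?_
    split_ifs <;> positivity
  · obtain ⟨n, hn⟩ := (hexp.eventually (gt_mem_nhds hε)).exists
    exact (eventually_agreePlus ω n).mono fun τ hτ => (dist1_le_of_agreePlus hτ).trans_lt hn

/-- The fiber maps of a skew product depend jointly continuously on base point and fiber point. -/
lemma continuous_uncurry_fiber [TopologicalSpace E] [DiscreteTopology E] [PseudoMetricSpace Y]
    {T : EAplus A → Y → Y} {C κ : ℝ} (hκ : 0 < κ) {r : ℝ} (hlip : ∀ ω : EAplus A, ∀ y z : Y, dist (T ω y) (T ω z) ≤ r * dist y z)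
    (hdinf : ∀ α β : EAplus A, ∀ ξ : Y, dist (T α ξ) (T β ξ) ≤ C * dist1 A κ α β) :
    Continuous fun p : EAplus A × Y => T p.1 p.2 := by
  rw [continuous_iff_continuousAt]
  rintro ⟨ω, y⟩
  refine tendsto_iff_dist_tendsto_zero.2 (squeeze_zero (fun _ => dist_nonneg)
    (g := fun p : EAplus A × Y => r * dist p.2 y + C * dist1 A κ p.1 ω) (fun p => ?_) ?_)
  · exact (dist_triangle _ (T p.1 y) _).trans (add_le_add (hlip _ _ _) (hdinf _ _ _))
  · have h₁ : Tendsto (fun p : EAplus A × Y => dist p.2 y) (𝓝 (ω, y)) (𝓝 0) :=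
      tendsto_iff_dist_tendsto_zero.1 continuous_snd.continuousAt
    have h₂ : Tendsto (fun p : EAplus A × Y => dist1 A κ p.1 ω) (𝓝 (ω, y)) (𝓝 0) :=
      (tendsto_dist1 hκ ω).comp (continuous_fst.tendsto (ω, y))
    simpa using (h₁.const_mul r).add (h₂.const_mul C)

/-- every skew product Smale system of global character is Hölder: the
projection `π̂₂` (hence `π̂`) is Hölder continuous and the induced map `T : J → J` is
continuous. -/
theorem statement10 {Y : Type*} [MetricSpace Y] [CompleteSpace Y]
    [TopologicalSpace E] [DiscreteTopology E]
    (hYb : Bornology.IsBounded (Set.univ : Set Y))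
    {A : E → E → Bool} (hA : FinitelyIrreducible A)
    (T : EAplus A → Y → Y) (lam : ℝ) (hlam : 1 < lam)
    (hcont : ∀ ω, Continuous (T ω)) (hclosed : ∀ ω, IsClosedMap (T ω))
    (hinjective : ∀ ω, Function.Injective (T ω))
    (hlip : ∀ ω : EAplus A, ∀ y z : Y, dist (T ω y) (T ω z) ≤ lam⁻¹ * dist y z)
    (C κ : ℝ) (hC : 0 < C) (hκ : 0 < κ) (hklam : κ ≤ Real.log lam / 2)
    (hdinf : ∀ α β : EAplus A, ∀ ξ : Y, dist (T α ξ) (T β ξ) ≤ C * dist1 A κ α β)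
    (pi2 : EA A → Y)
    (hpi2 : ∀ τ : EA A,
      (⋂ n : ℕ, closure (Tcomp A T τ (n + 1) '' (Set.univ : Set Y))) = {pi2 τ}) :
    (∃ C' θ : ℝ, 0 < C' ∧ 0 < θ ∧
      ∀ α β : EA A, dist (pi2 α) (pi2 β) ≤ C' * dist2 A κ α β ^ θ) ∧
    ContinuousOn (fun p : EAplus A × Y => (shiftPlus A p.1, T p.1 p.2))
      (Set.range fun τ : EA A => (proj1 A τ, pi2 τ)) := by
  obtain ⟨D, hD⟩ := Metric.isBounded_iff.1 hYb
  replace hD : ∀ x y : Y, dist x y ≤ D := fun x y => hD (mem_univ x) (mem_univ y)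
  have hlam0 : 0 < lam := one_pos.trans hlam
  have hr0 : 0 ≤ lam⁻¹ := inv_nonneg.2 hlam0.le
  have hr1 : lam⁻¹ < 1 := inv_lt_one_of_one_lt₀ hlam
  have hS : 0 < (1 - lam⁻¹)⁻¹ := inv_pos.2 (sub_pos.2 hr1)
  have hpow : ∀ N : ℕ, lam⁻¹ ^ N ≤ Real.exp (-κ * N) := fun N => by
    rw [mul_comm, Real.exp_nat_mul]
    refine pow_le_pow_left₀ hr0 ?_ N
    rw [← Real.exp_log (inv_pos.2 hlam0), Real.log_inv]
    exact Real.exp_le_exp.2 (by linarith)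
  set K : ℝ := |D| + (1 - lam⁻¹)⁻¹ * C with hKdef
  have hK : 0 < K := add_pos_of_nonneg_of_pos (abs_nonneg D) (mul_pos hS hC)
  have hDK : D ≤ K := (le_abs_self D).trans (le_add_of_nonneg_right (mul_pos hS hC).le)
  have hmem : ∀ (τ : EA A) (n : ℕ), pi2 τ ∈ closure (Tcomp A T τ n '' (Set.univ : Set Y)) :=
    fun τ => mem_closure_Tcomp (by rw [hpi2 τ]; rfl)
  have key : ∀ (α β : EA A) (N : ℕ), agreeTwo α β N →
      dist (pi2 α) (pi2 β) ≤ K * Real.exp (-κ * N) := by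
    intro α β N h
    refine dist_le_of_mem_closure_of_mem_closure ?_ (hmem α N) (hmem β N)
    rintro _ ⟨y, -, rfl⟩ _ ⟨z, -, rfl⟩
    have hsum : ∑ m ∈ Finset.range N, lam⁻¹ ^ m ≤ (1 - lam⁻¹)⁻¹ :=
      (summable_geometric_of_lt_one hr0 hr1).sum_le_tsum _ (fun _ _ => by positivity) |>.trans_eq
        (tsum_geometric_of_lt_one hr0 hr1)
    calc _ ≤ _ := dist_Tcomp_le hr0 hC.le hlip hdinf h N le_rfl y z
      _ ≤ Real.exp (-κ * N) * |D| + (1 - lam⁻¹)⁻¹ * (C * Real.exp (-κ * N)) := by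
        gcongr
        · exact hpow N
        · exact (hD y z).trans (le_abs_self D)
      _ = K * Real.exp (-κ * N) := by rw [hKdef]; ring
  refine ⟨⟨K, 1, hK, one_pos, fun α β => ?_⟩, ?_⟩
  · rw [Real.rpow_one, ← div_le_iff₀' hK]
    refine le_ciInf fun n => ?_
    rw [div_le_iff₀' hK]
    split_ifs with h
    · exact key α β n h
    · exact (hD _ _).trans (hDK.trans (le_mul_of_one_le_right hK.le (Real.one_le_exp hκ.le)))
  · exact ((continuous_shiftPlus.comp continuous_fst).prodMk
      (continuous_uncurry_fiber hκ hlip hdinf)).continuousOn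

end Paper
end

section
/- Let T be a conformal skew product Smale endomorphism (satisfying conditions (a)–(g)). Then for every n ≥ 1, every τ ∈ E_A, and every γ ∈ E_A with γ|₀^{+∞} = τ|₀^{+∞}: if π̂₂(γ) ∈ T_τⁿ(Int(Y_{τ|_{−n}^{+∞}})), then γ_k = τ_k for all −n ≤ k ≤ −1; that is, π̂₂⁻¹(T_τⁿ(Int Y_{τ|_{−n}^{+∞}})) ∩ {γ : γ|₀^{+∞} = τ|₀^{+∞}} is contained in the cylinder [τ|_{−n}^{+∞}]. -/
open MeasureTheory Filter Set Topology

open scoped ENNReal Classical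

namespace Paper

variable {E : Type*}

variable {A : E → E → Bool}

variable {Y : Type*}

theorem tail_apply (τ : EA A) (n k : ℕ) : (tail A τ n).1 k = τ.1 ((k : ℤ) - (n : ℤ)) := rfl

theorem tail_eq_iff {τ γ : EA A} {n : ℕ} :
    tail A γ n = tail A τ n ↔ ∀ k : ℤ, -(n : ℤ) ≤ k → γ.1 k = τ.1 k := by
  constructor
  · intro h k hk
    have h' := congrArg (fun ω : EAplus A => ω.1 (k + n).toNat) h
    simp only [tail_apply] at h'
    rwa [Int.toNat_of_nonneg (by omega), add_sub_cancel_right] at h'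
  · intro h
    exact Subtype.ext (funext fun k => h _ (by omega))

theorem tail_zero (τ : EA A) : tail A τ 0 = proj1 A τ :=
  Subtype.ext (funext fun k => by simp [tail_apply, proj1])

theorem shiftPlus_tail_succ (τ : EA A) (n : ℕ) :
    shiftPlus A (tail A τ (n + 1)) = tail A τ n :=
  Subtype.ext (funext fun k => congrArg τ.1
    (show ((k + 1 : ℕ) : ℤ) - ((n + 1 : ℕ) : ℤ) = (k : ℤ) - n by omega))

theorem cons_shiftPlus (ω : EAplus A) :
    cons A (ω.1 0) (shiftPlus A ω) (ω.2 0) = ω :=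
  Subtype.ext (funext fun k => by cases k <;> rfl)

/-- `Tcomp A T τ n` depends only on `τ|_{-n}^{+∞}`. -/
theorem Tcomp_congr (T : EAplus A → Y → Y) {τ γ : EA A} :
    ∀ {n : ℕ}, tail A γ n = tail A τ n → Tcomp A T γ n = Tcomp A T τ n
  | 0, _ => rfl
  | n + 1, h => by
    have h' : tail A γ n = tail A τ n := by
      rw [← shiftPlus_tail_succ, h, shiftPlus_tail_succ]
    rw [Tcomp, Tcomp, h, Tcomp_congr T h']

namespace CSS

variable [MeasurableSpace E] {d : ℕ} (S : CSS A d)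

theorem continuousOn_T (ω : EAplus A) : ContinuousOn (S.T ω) (S.Ystar ω) :=
  (S.hC1 ω).continuousOn

theorem isOpen_image_T (ω : EAplus A) {U : Set (EuclideanSpace ℝ (Fin d))} (hU : IsOpen U)
    (hUY : U ⊆ S.Ystar ω) : IsOpen (S.T ω '' U) := by
  rw [isOpen_iff_mem_nhds]
  rintro _ ⟨x, hx, rfl⟩
  obtain ⟨f', hf', hc⟩ := S.hconf ω x (hUY hx)
  have hstrict : HasStrictFDerivAt (S.T ω) f' x :=
    ((S.hC1 ω).contDiffAt ((S.hstar_open ω).mem_nhds (hUY hx))).hasStrictFDerivAt' hf' one_ne_zero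
  have hsurj : Function.Surjective (f' : EuclideanSpace ℝ (Fin d) →ₗ[ℝ] _) :=
    LinearMap.surjective_of_injective hc.injective
  rw [← hstrict.map_nhds_eq_of_surj (LinearMap.range_eq_top.2 hsurj)]
  exact image_mem_map (hU.mem_nhds hx)

theorem mapsTo_interior (ω : EAplus A) :
    MapsTo (S.T ω) (interior (S.Yset ω)) (interior (S.Yset (shiftPlus A ω))) :=
  mapsTo_iff_image_subset.2 <| interior_maximal
    ((S.hmapsY ω).mono_left interior_subset).image_subset
    (S.isOpen_image_T ω isOpen_interior (interior_subset.trans (S.hYsub ω)))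

theorem mapsTo_T_tail_succ (τ : EA A) (n : ℕ) :
    MapsTo (S.T (tail A τ (n + 1))) (S.Ystar (tail A τ (n + 1))) (S.Ystar (tail A τ n)) := by
  simpa only [shiftPlus_tail_succ] using S.hmapsStar (tail A τ (n + 1))

theorem continuousOn_Tcomp (τ : EA A) :
    ∀ n, ContinuousOn (Tcomp A S.T τ n) (S.Ystar (tail A τ n))
  | 0 => continuousOn_id
  | n + 1 => (continuousOn_Tcomp τ n).comp (S.continuousOn_T _) (S.mapsTo_T_tail_succ τ n)

theorem injOn_Tcomp (τ : EA A) : ∀ n, InjOn (Tcomp A S.T τ n) (S.Ystar (tail A τ n))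
  | 0 => injOn_id _
  | n + 1 => (injOn_Tcomp τ n).comp (S.hinj _) (S.mapsTo_T_tail_succ τ n)

theorem isOpen_image_Tcomp (τ : EA A) :
    ∀ (n : ℕ) {U : Set (EuclideanSpace ℝ (Fin d))}, IsOpen U → U ⊆ S.Ystar (tail A τ n) →
      IsOpen (Tcomp A S.T τ n '' U)
  | 0, U, hU, _ => by simpa [Tcomp] using hU
  | n + 1, U, hU, hUY => by
    rw [Tcomp, image_comp]
    exact isOpen_image_Tcomp τ n (S.isOpen_image_T _ hU hUY)
      ((S.mapsTo_T_tail_succ τ n).mono_left hUY).image_subset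

theorem isCompact_Yset (ω : EAplus A) : IsCompact (S.Yset ω) :=
  Metric.isCompact_of_isClosed_isBounded (S.hYclosed ω) (S.hYbdd.subset (subset_iUnion _ ω))

theorem pi2_mem_closure_image_interior (γ : EA A) (n : ℕ) :
    S.pi2 γ ∈ closure (Tcomp A S.T γ (n + 1) '' interior (S.Yset (tail A γ (n + 1)))) := by
  have hcont : ContinuousOn (Tcomp A S.T γ (n + 1)) (S.Yset (tail A γ (n + 1))) :=
    (S.continuousOn_Tcomp γ (n + 1)).mono (S.hYsub _)
  have hmem : S.pi2 γ ∈ closure (Tcomp A S.T γ (n + 1) '' S.Yset (tail A γ (n + 1))) :=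
    mem_iInter.1 ((S.hpi2 γ).symm ▸ mem_singleton (S.pi2 γ)) n
  rw [((S.isCompact_Yset _).image_of_continuousOn hcont).isClosed.closure_eq, S.hYreg] at hmem
  rw [S.hYreg] at hcont
  exact hcont.image_closure hmem

/-- If the images of the interiors under two branches with the same nonnegative part meet, the
branches coincide. -/
theorem tail_eq_of_Tcomp_eq {τ γ : EA A} (h0 : proj1 A γ = proj1 A τ) :
    ∀ (n : ℕ) {u v : EuclideanSpace ℝ (Fin d)}, u ∈ interior (S.Yset (tail A τ n)) →
      v ∈ interior (S.Yset (tail A γ n)) → Tcomp A S.T γ n v = Tcomp A S.T τ n u →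
      tail A γ n = tail A τ n
  | 0, _, _, _, _, _ => by rw [tail_zero, tail_zero, h0]
  | n + 1, u, v, hu, hv, huv => by
    have hu' := S.mapsTo_interior _ hu
    have hv' := S.mapsTo_interior _ hv
    rw [shiftPlus_tail_succ] at hu' hv'
    have hn : tail A γ n = tail A τ n := tail_eq_of_Tcomp_eq h0 n hu' hv' huv
    have hT : S.T (tail A γ (n + 1)) v = S.T (tail A τ (n + 1)) u := by
      refine S.injOn_Tcomp τ n ?_ (S.hYsub _ (interior_subset hu')) ?_
      · rw [← hn]
        exact S.hYsub _ (interior_subset hv')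
      · rw [Tcomp, Tcomp, Tcomp_congr S.T hn] at huv
        exact huv
    have hs : shiftPlus A (tail A γ (n + 1)) = shiftPlus A (tail A τ (n + 1)) := by
      rw [shiftPlus_tail_succ, shiftPlus_tail_succ, hn]
    generalize tail A γ (n + 1) = ω at *
    generalize tail A τ (n + 1) = η at *
    rw [← cons_shiftPlus ω, ← cons_shiftPlus η]
    have ha : A (ω.1 0) ((shiftPlus A η).1 0) = true := hs ▸ ω.2 0
    have hω : cons A (ω.1 0) (shiftPlus A η) ha = ω := by
      simp only [← hs, cons_shiftPlus]
    by_cases hab : ω.1 0 = η.1 0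
    · simp only [hs, hab]
    · have hdisj := S.hOSC (shiftPlus A η) (ω.1 0) (η.1 0) ha (η.2 0) hab
      rw [hω, cons_shiftPlus] at hdisj
      exact absurd ⟨u, hu, hT.symm⟩ (disjoint_left.1 hdisj ⟨v, hv, rfl⟩)

end CSS

/-- for a conformal skew product Smale endomorphism,
`π̂₂⁻¹(T_τ^n(Int Y_{τ|_{-n}^{+∞}}))` (within sequences with the same nonnegative part
as `τ`) is contained in the cylinder `[τ|_{-n}^{+∞}]`. -/
theorem statement11 [Countable E] [MeasurableSpace E] {A : E → E → Bool}
    (hA : FinitelyIrreducible A) {d : ℕ} (S : CSS A d) :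
    ∀ n : ℕ, 1 ≤ n → ∀ τ γ : EA A, proj1 A γ = proj1 A τ →
      S.pi2 γ ∈ Tcomp A S.T τ n '' interior (S.Yset (tail A τ n)) →
      ∀ k : ℤ, -(n : ℤ) ≤ k → k ≤ -1 → γ.1 k = τ.1 k := by
  rintro n hn τ γ h0 hmem k hk -
  obtain ⟨m, rfl⟩ := Nat.exists_eq_add_of_le' hn
  have hopen := S.isOpen_image_Tcomp τ (m + 1) isOpen_interior
    (interior_subset.trans (S.hYsub (tail A τ (m + 1))))
  obtain ⟨_, ⟨u, hu, rfl⟩, v, hv, huv⟩ :=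
    mem_closure_iff.1 (S.pi2_mem_closure_image_interior γ m) _ hopen hmem
  exact tail_eq_iff.1 (S.tail_eq_of_Tcomp_eq h0 (m + 1) hu hv huv) k hk

end Paper
end
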